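/- (Regularity lemma with boundary) Let h : ℝ^d → ℝ^m and g : ℝ^d → ℝ^l be twice continuously differentiable, let Σ := {x ∈ ℝ^d : h(x) = 0 and g_i(x) ≤ 0 for all i} be nonempty and compact, and assume LICQ holds on Σ: for every y ∈ Σ the vectors {∇h_j(y)}_{j=1}^m ∪ {∇g_i(y)}_{i ∈ I_y} are linearly independent, where I_y := {i ∈ {1,…,l} : g_i(y) ≥ 0}. Then there exist ε̂ > 0 and κ > 0 such that for every x ∈ ℝ^d with dist(x, Σ) < ε̂ and every y ∈ Σ attaining the distance (i.e. ‖x − y‖₂ = dist(x, Σ)), one has ‖h(x)‖₂ + ‖(g_i(x))_{i ∈ I_y}‖₂ ≥ κ·‖x − y‖₂. -/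

import Mathlib

open Filter Topology

/-- A `C²` function is strictly differentiable, with derivative the pairing with its gradient. -/
lemma ContDiff.hasStrictFDerivAt_innerSL_gradient {E : Type*} [NormedAddCommGroup E]
    [InnerProductSpace ℝ E] [CompleteSpace E] {f : E → ℝ} (hf : ContDiff ℝ 2 f) (y : E) :
    HasStrictFDerivAt f (innerSL ℝ (gradient f y)) y := by
  have h1 := hf.contDiffAt (x := y) |>.hasStrictFDerivAt (by norm_num)
  have h2 : innerSL ℝ (gradient f y) = fderiv ℝ f y := by
    ext v
    simp [gradient, InnerProductSpace.toDual_symm_apply]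
  rwa [h2]

lemma ContDiff.continuous_gradient {E : Type*} [NormedAddCommGroup E]
    [InnerProductSpace ℝ E] [CompleteSpace E] {f : E → ℝ} (hf : ContDiff ℝ 2 f) :
    Continuous (gradient f) :=
  (InnerProductSpace.toDual ℝ E).symm.continuous.comp (hf.continuous_fderiv (by norm_num))

/-- At a point `y` of a regular level set locally closest to `x`, the vector `x - y` is a
combination of the gradients of the constraints. -/
lemma exists_sub_eq_sum_smul_of_isLocalMinOn {E ι : Type*} [NormedAddCommGroup E]
    [InnerProductSpace ℝ E] [CompleteSpace E] [Fintype ι] {f : ι → E → ℝ} {G : ι → E} {x y : E}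
    (hf : ∀ k, HasStrictFDerivAt (f k) (innerSL ℝ (G k)) y) (hG : LinearIndependent ℝ G)
    (hmin : IsLocalMinOn (fun z => ‖z - x‖ ^ 2) {z | ∀ k, f k z = f k y} y) :
    ∃ c : ι → ℝ, x - y = ∑ k, c k • G k := by
  have hφ : HasStrictFDerivAt (fun z => ‖z - x‖ ^ 2) (2 • innerSL ℝ (y - x)) y := by
    have h1 := (hasStrictFDerivAt_norm_sq (y - x)).comp y
      ((hasStrictFDerivAt_id (𝕜 := ℝ) y).sub_const x)
    exact h1
  obtain ⟨Λ, Λ₀, hne, hsum⟩ :=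
    IsLocalExtrOn.exists_multipliers_of_hasStrictFDerivAt (Or.inl hmin) hf hφ
  have hvec : ∑ k, Λ k • G k + (2 * Λ₀) • (y - x) = 0 := by
    refine ext_inner_right ℝ fun v => ?_
    have h1 := congrArg (fun L : StrongDual ℝ E => L v) hsum
    simp only [add_apply, sum_apply,
      smul_apply, innerSL_apply_apply, smul_eq_mul, nsmul_eq_mul,
      zero_apply, Nat.cast_ofNat] at h1
    rw [inner_add_left, sum_inner, inner_zero_left, real_inner_smul_left]
    simp only [real_inner_smul_left]
    linarith
  have hΛ₀ : Λ₀ ≠ 0 := by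
    rintro rfl
    apply hne
    have := Fintype.linearIndependent_iff.1 hG Λ (by simpa using hvec)
    ext k
    · exact this k
    · rfl
  refine ⟨fun k => (2 * Λ₀)⁻¹ * Λ k, ?_⟩
  simp only [mul_smul, ← Finset.smul_sum]
  rw [eq_neg_of_add_eq_zero_left hvec, ← smul_neg, smul_smul,
    inv_mul_cancel₀ (by simpa using hΛ₀), one_smul, neg_sub]

/-- Near a point where continuous vector fields are linearly independent, coefficients are
uniformly controlled by linear combinations. -/
lemma LinearIndependent.exists_forall_nhds_norm_le {E ι X : Type*} [NormedAddCommGroup E]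
    [NormedSpace ℝ E] [Fintype ι] [TopologicalSpace X] {G : ι → X → E} {y₀ : X}
    (hG : ∀ k, ContinuousAt (G k) y₀) (hli : LinearIndependent ℝ fun k => G k y₀) :
    ∃ C > (0 : ℝ), ∀ᶠ y in 𝓝 y₀, ∀ c : ι → ℝ, ‖c‖ ≤ C * ‖∑ k, c k • G k y‖ := by
  obtain ⟨K, hK, hanti⟩ := LinearMap.exists_antilipschitzWith
    (Fintype.linearCombination ℝ fun k => G k y₀)
    (LinearMap.ker_eq_bot.2 hli.fintypeLinearCombination_injective)
  have hK' : (0 : ℝ) < K := hK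
  have hlow : ∀ c : ι → ℝ, ‖c‖ ≤ K * ‖∑ k, c k • G k y₀‖ := fun c => by
    simpa [Fintype.linearCombination_apply] using hanti.le_mul_norm (map_zero _) c
  refine ⟨2 * K, by positivity, ?_⟩
  have hcont : ContinuousAt (fun y => ∑ k, ‖G k y₀ - G k y‖) y₀ :=
    tendsto_finsetSum _ fun k _ => (continuousAt_const.sub (hG k)).norm
  have hev : ∀ᶠ y in 𝓝 y₀, ∑ k, ‖G k y₀ - G k y‖ < 1 / (2 * K) :=
    hcont.eventually_lt continuousAt_const (by simpa using hK')
  filter_upwards [hev] with y hy c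
  have h1 : ‖∑ k, c k • (G k y₀ - G k y)‖ ≤ ‖c‖ * (1 / (2 * K)) := by
    calc _ ≤ ∑ k, ‖c k • (G k y₀ - G k y)‖ := norm_sum_le _ _
      _ ≤ ∑ k, ‖c‖ * ‖G k y₀ - G k y‖ := by
        gcongr with k
        rw [norm_smul]
        gcongr
        exact norm_le_pi_norm c k
      _ = ‖c‖ * ∑ k, ‖G k y₀ - G k y‖ := by rw [Finset.mul_sum]
      _ ≤ _ := by gcongr
  have h2 : ∑ k, c k • G k y₀ = ∑ k, c k • (G k y₀ - G k y) + ∑ k, c k • G k y := by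
    simp only [smul_sub, Finset.sum_sub_distrib, sub_add_cancel]
  have h3 := hlow c
  rw [h2] at h3
  have h4 : ‖c‖ ≤ K * (‖c‖ * (1 / (2 * K)) + ‖∑ k, c k • G k y‖) :=
    h3.trans (by gcongr; exact (norm_add_le _ _).trans (by gcongr))
  have h5 : K * (‖c‖ * (1 / (2 * K)) + ‖∑ k, c k • G k y‖)
      = ‖c‖ / 2 + K * ‖∑ k, c k • G k y‖ := by
    field_simp
  linarith

/-- Near a point where the gradients `G k` of the functions `f k` are linearly independent, a
displacement in the span of some of the gradients is controlled by the increments of the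
corresponding functions. -/
lemma exists_forall_nhds_norm_sub_le_sum {E ι : Type*} [NormedAddCommGroup E]
    [InnerProductSpace ℝ E] [Fintype ι] {f : ι → E → ℝ} {G : ι → E → E} {y₀ : E}
    (hf : ∀ k, HasStrictFDerivAt (f k) (innerSL ℝ (G k y₀)) y₀)
    (hG : ∀ k, ContinuousAt (G k) y₀) (hli : LinearIndependent ℝ fun k => G k y₀) :
    ∃ C > (0 : ℝ), ∀ᶠ p in 𝓝 (y₀, y₀), ∀ c : ι → ℝ, p.1 - p.2 = ∑ k, c k • G k p.2 →
      ‖p.1 - p.2‖ ≤ C * ∑ k with c k ≠ 0, |f k p.1 - f k p.2| := by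
  obtain ⟨C, hC, hcoef⟩ := hli.exists_forall_nhds_norm_le hG
  set ε : ℝ := 1 / (4 * C * (Fintype.card ι + 1)) with hε
  have hε0 : 0 < ε := by positivity
  have h1 : ∀ᶠ p in 𝓝 (y₀, y₀), ∀ k,
      ‖f k p.1 - f k p.2 - innerSL ℝ (G k y₀) (p.1 - p.2)‖ ≤ ε * ‖p.1 - p.2‖ :=
    eventually_all.2 fun k => (hf k).isLittleO.def hε0
  have h2 : ∀ᶠ y in 𝓝 y₀, ∀ k, ‖G k y - G k y₀‖ < ε :=
    eventually_all.2 fun k => by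
      simpa [dist_eq_norm] using Metric.tendsto_nhds.1 (hG k) ε hε0
  have hsnd : Tendsto Prod.snd (𝓝 (y₀, y₀)) (𝓝 y₀) := continuous_snd.continuousAt
  refine ⟨2 * C, by positivity, ?_⟩
  filter_upwards [h1, hsnd.eventually h2, hsnd.eventually hcoef] with ⟨x, y⟩ h1 h2 h3 c hc
  simp only at h1 h2 h3 hc ⊢
  have hcn : ‖c‖ ≤ C * ‖x - y‖ := by rw [hc]; exact h3 c
  have hinner : ∀ k, |inner ℝ (G k y) (x - y)| ≤ |f k x - f k y| + 2 * ε * ‖x - y‖ := by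
    intro k
    have e : inner ℝ (G k y) (x - y) = (f k x - f k y) + inner ℝ (G k y - G k y₀) (x - y)
        - (f k x - f k y - inner ℝ (G k y₀) (x - y)) := by
      rw [inner_sub_left]; ring
    have a1 : |inner ℝ (G k y - G k y₀) (x - y)| ≤ ε * ‖x - y‖ :=
      (abs_real_inner_le_norm _ _).trans (by gcongr; exact (h2 k).le)
    have a2 : |f k x - f k y - inner ℝ (G k y₀) (x - y)| ≤ ε * ‖x - y‖ := h1 k
    rw [e]
    have a3 := abs_sub ((f k x - f k y) + inner ℝ (G k y - G k y₀) (x - y))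
      (f k x - f k y - inner ℝ (G k y₀) (x - y))
    have a4 := abs_add_le (f k x - f k y) (inner ℝ (G k y - G k y₀) (x - y))
    linarith
  set T := ∑ k with c k ≠ 0, |f k x - f k y|
  have hsq : ‖x - y‖ ^ 2 ≤ C * ‖x - y‖ * T + ‖x - y‖ ^ 2 / 2 := by
    calc ‖x - y‖ ^ 2 = inner ℝ (∑ k, c k • G k y) (x - y) := by
          rw [← hc, real_inner_self_eq_norm_sq]
      _ = ∑ k, c k * inner ℝ (G k y) (x - y) := by simp [sum_inner, real_inner_smul_left]
      _ = ∑ k with c k ≠ 0, c k * inner ℝ (G k y) (x - y) := by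
          rw [Finset.sum_filter_of_ne]
          intro k _ hk
          exact left_ne_zero_of_mul hk
      _ ≤ ∑ k with c k ≠ 0, C * ‖x - y‖ * (|f k x - f k y| + 2 * ε * ‖x - y‖) := by
          refine Finset.sum_le_sum fun k _ => ?_
          refine (le_abs_self _).trans ?_
          rw [abs_mul]
          gcongr
          · exact (norm_le_pi_norm c k).trans hcn
          · exact hinner k
      _ = C * ‖x - y‖ * T + (Finset.univ.filter fun k => c k ≠ 0).card *
            (C * ‖x - y‖ * (2 * ε * ‖x - y‖)) := by
          rw [← Finset.mul_sum, Finset.sum_add_distrib, Finset.sum_const, nsmul_eq_mul]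
          ring
      _ ≤ C * ‖x - y‖ * T + (Fintype.card ι + 1) * (C * ‖x - y‖ * (2 * ε * ‖x - y‖)) := by
          gcongr
          exact (Nat.cast_le.2 (Finset.card_le_univ _)).trans (by linarith)
      _ = C * ‖x - y‖ * T + ‖x - y‖ ^ 2 / 2 := by
          rw [hε]
          field_simp
          ring
  rcases (norm_nonneg (x - y)).eq_or_lt with h0 | h0
  · rw [← h0]
    have : 0 ≤ T := Finset.sum_nonneg fun _ _ => abs_nonneg _
    positivity
  · nlinarith


/-- Regularity lemma with boundary (Lemma C.4): under LICQ on the compact set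
`Σ = {h = 0, g ≤ 0}`, there are `ε̂, κ > 0` such that for `x` with `dist(x, Σ) < ε̂` and
any nearest point `y ∈ Σ`,
`‖h(x)‖ + ‖(g_i(x))_{i ∈ I_y}‖ ≥ κ ‖x - y‖`, where `I_y = {i : g_i(y) ≥ 0}`. -/
theorem regularity_lemma_with_boundary
    {d m l : ℕ}
    (h : EuclideanSpace ℝ (Fin d) → EuclideanSpace ℝ (Fin m))
    (g : EuclideanSpace ℝ (Fin d) → (Fin l → ℝ))
    (hh : ContDiff ℝ 2 h) (hg : ContDiff ℝ 2 g)
    (S : Set (EuclideanSpace ℝ (Fin d)))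
    (hS : S = {x | h x = 0 ∧ ∀ i, g x i ≤ 0})
    (hne : S.Nonempty) (hcomp : IsCompact S)
    (licq : ∀ y ∈ S, LinearIndependent ℝ
      (Sum.elim (fun j : Fin m => gradient (fun x => h x j) y)
        (fun i : {i : Fin l // 0 ≤ g y i} => gradient (fun x => g x i.1) y))) :
    ∃ εhat > (0 : ℝ), ∃ κ > (0 : ℝ),
      ∀ x : EuclideanSpace ℝ (Fin d), Metric.infDist x S < εhat →
        ∀ y ∈ S, dist x y = Metric.infDist x S →
          κ * ‖x - y‖ ≤ ‖h x‖ +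
            Real.sqrt (∑ i ∈ Finset.univ.filter (fun i : Fin l => 0 ≤ g y i),
              (g x i) ^ 2) := by
  have hhc : ∀ j, ContDiff ℝ 2 fun x => h x j := contDiff_euclidean.1 hh
  have hgc : ∀ i, ContDiff ℝ 2 fun x => g x i := contDiff_pi.1 hg
  have hmem : ∀ y, y ∈ S ↔ h y = 0 ∧ ∀ i, g y i ≤ 0 := fun y => by rw [hS]; rfl
  have hneg : ∀ y₀, ∀ᶠ y in 𝓝 y₀, ∀ i, g y₀ i < 0 → g y i < 0 := fun y₀ =>
    eventually_all.2 fun i => by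
      by_cases hi : g y₀ i < 0
      · filter_upwards [(hgc i).continuous.continuousAt.eventually_lt continuousAt_const hi]
          with y hy _ using hy
      · exact Eventually.of_forall fun _ h' => absurd h' hi
  -- first-order optimality of a nearest point
  have hfoc : ∀ x, ∀ y ∈ S, dist x y = Metric.infDist x S →
      ∃ c : Fin m ⊕ {i : Fin l // 0 ≤ g y i} → ℝ, x - y = ∑ k, c k •
        Sum.elim (fun j : Fin m => gradient (fun x => h x j) y)
          (fun i : {i : Fin l // 0 ≤ g y i} => gradient (fun x => g x i.1) y) k := by
    intro x y hy hxy
    refine exists_sub_eq_sum_smul_of_isLocalMinOn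
      (f := Sum.elim (fun j x => h x j) (fun i x => g x i.1)) ?_ (licq y hy) ?_
    · rintro (j | i)
      · exact (hhc j).hasStrictFDerivAt_innerSL_gradient y
      · exact (hgc i).hasStrictFDerivAt_innerSL_gradient y
    · have hev : ∀ᶠ z in 𝓝[{z | ∀ k, Sum.elim (fun j x => h x j)
          (fun (i : {i : Fin l // 0 ≤ g y i}) x => g x i.1) k z = Sum.elim (fun j x => h x j)
          (fun (i : {i : Fin l // 0 ≤ g y i}) x => g x i.1) k y}] y,
          ‖y - x‖ ^ 2 ≤ ‖z - x‖ ^ 2 := by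
        filter_upwards [self_mem_nhdsWithin, nhdsWithin_le_nhds (hneg y)] with z hz hzneg
        have hzS : z ∈ S := by
          refine (hmem z).2 ⟨?_, fun i => ?_⟩
          · rw [← ((hmem y).1 hy).1]
            ext j
            exact hz (Sum.inl j)
          · by_cases hi : 0 ≤ g y i
            · exact (hz (Sum.inr ⟨i, hi⟩)).trans_le (((hmem y).1 hy).2 i)
            · exact (hzneg i (not_le.1 hi)).le
        have := hxy.trans_le (Metric.infDist_le_dist_of_mem (x := x) hzS)
        rw [dist_comm x y, dist_comm x z, dist_eq_norm, dist_eq_norm] at this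
        gcongr
      exact hev
  suffices H : ∃ κ > (0 : ℝ), ∃ δ > (0 : ℝ), ∀ y ∈ S, y ∈ S → ∀ x, ‖x - y‖ < δ →
      dist x y = Metric.infDist x S → κ * ‖x - y‖ ≤ ‖h x‖ +
        Real.sqrt (∑ i ∈ Finset.univ.filter (fun i : Fin l => 0 ≤ g y i), (g x i) ^ 2) by
    obtain ⟨κ, hκ, δ, hδ, H⟩ := H
    refine ⟨δ, hδ, κ, hκ, fun x hx y hy hxy => H y hy hy x ?_ hxy⟩
    rwa [← dist_eq_norm, hxy]
  refine hcomp.induction_on (p := fun T => ∃ κ > (0 : ℝ), ∃ δ > (0 : ℝ), ∀ y ∈ T, y ∈ S →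
    ∀ x, ‖x - y‖ < δ → dist x y = Metric.infDist x S → κ * ‖x - y‖ ≤ ‖h x‖ +
      Real.sqrt (∑ i ∈ Finset.univ.filter (fun i : Fin l => 0 ≤ g y i), (g x i) ^ 2))
    ⟨1, one_pos, 1, one_pos, fun y hy => absurd hy (Set.notMem_empty y)⟩ ?_ ?_ ?_
  · rintro s t hst ⟨κ, hκ, δ, hδ, H⟩
    exact ⟨κ, hκ, δ, hδ, fun y hy => H y (hst hy)⟩
  · rintro s t ⟨κ, hκ, δ, hδ, H⟩ ⟨κ', hκ', δ', hδ', H'⟩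
    refine ⟨min κ κ', lt_min hκ hκ', min δ δ', lt_min hδ hδ', ?_⟩
    rintro y (hy | hy) hyS x hx hxy
    · refine le_trans ?_ (H y hy hyS x (hx.trans_le (min_le_left _ _)) hxy)
      gcongr
      exact min_le_left _ _
    · refine le_trans ?_ (H' y hy hyS x (hx.trans_le (min_le_right _ _)) hxy)
      gcongr
      exact min_le_right _ _
  intro y₀ hy₀
  let f : Fin m ⊕ {i : Fin l // 0 ≤ g y₀ i} → EuclideanSpace ℝ (Fin d) → ℝ :=
    Sum.elim (fun j x => h x j) (fun i x => g x i.1)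
  have hfc : ∀ k, ContDiff ℝ 2 (f k) := by
    rintro (j | i)
    · exact hhc j
    · exact hgc i
  have hli : LinearIndependent ℝ fun k => gradient (f k) y₀ := by
    convert licq y₀ hy₀ using 1
    ext1 (j | i) <;> rfl
  obtain ⟨C, hC, hev⟩ := exists_forall_nhds_norm_sub_le_sum
    (fun k => (hfc k).hasStrictFDerivAt_innerSL_gradient y₀)
    (fun k => (hfc k).continuous_gradient.continuousAt) hli
  obtain ⟨δ, hδ, hball⟩ := Metric.eventually_nhds_iff.1 hev
  refine ⟨_, mem_nhdsWithin_of_mem_nhds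
    (inter_mem (Metric.ball_mem_nhds y₀ (half_pos hδ)) (hneg y₀)),
    1 / (C * Fintype.card (Fin m ⊕ {i : Fin l // 0 ≤ g y₀ i}) + 1), by positivity,
    δ / 2, half_pos hδ, ?_⟩
  rintro y ⟨hyball, hyneg⟩ hyS x hx hxy
  simp only [Set.mem_ofPred_eq] at hyneg
  obtain ⟨c', hc'⟩ := hfoc x y hyS hxy
  -- extend the multipliers by zero to the constraints active at `y₀`
  let c : Fin m ⊕ {i : Fin l // 0 ≤ g y₀ i} → ℝ := Sum.elim (fun j => c' (Sum.inl j))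
    (fun i => if hi : 0 ≤ g y i.1 then c' (Sum.inr ⟨i.1, hi⟩) else 0)
  have hc : x - y = ∑ k, c k • gradient (f k) y := by
    rw [hc', Fintype.sum_sum_type, Fintype.sum_sum_type]
    congr 1
    let a : Fin l → EuclideanSpace ℝ (Fin d) := fun i =>
      if hi : 0 ≤ g y i then c' (Sum.inr ⟨i, hi⟩) • gradient (fun x => g x i) y else 0
    have e1 : ∑ i : {i : Fin l // 0 ≤ g y i}, a i.1 = ∑ i, a i := by
      rw [← Finset.sum_subtype (Finset.univ.filter fun i => 0 ≤ g y i) (by simp) a]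
      refine Finset.sum_filter_of_ne fun i _ hi => ?_
      by_contra hn
      exact hi (dif_neg hn)
    have e2 : ∑ i : {i : Fin l // 0 ≤ g y₀ i}, a i.1 = ∑ i, a i := by
      rw [← Finset.sum_subtype (Finset.univ.filter fun i => 0 ≤ g y₀ i) (by simp) a]
      refine Finset.sum_filter_of_ne fun i _ hi => ?_
      by_contra hn
      exact hi (dif_neg (not_le.2 (hyneg i (not_le.1 hn))))
    refine Eq.trans ?_ ((e1.trans e2.symm).trans ?_)
    · exact Finset.sum_congr rfl fun i _ => by simp [a, i.2]
    · refine Finset.sum_congr rfl fun i _ => ?_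
      by_cases hi : 0 ≤ g y i.1 <;> simp [a, c, f, hi]
  have hpair : dist (x, y) (y₀, y₀) < δ := by
    rw [Metric.mem_ball] at hyball
    rw [← dist_eq_norm] at hx
    rw [Prod.dist_eq]
    exact max_lt ((dist_triangle x y y₀).trans_lt (by linarith)) (hyball.trans (half_lt_self hδ))
  have hmain := hball hpair c hc
  simp only at hmain
  set R := ‖h x‖ +
    Real.sqrt (∑ i ∈ Finset.univ.filter (fun i : Fin l => 0 ≤ g y i), (g x i) ^ 2) with hR
  have hR0 : 0 ≤ R := by positivity
  have hterm : ∀ k ∈ Finset.univ.filter (fun k => c k ≠ 0), |f k x - f k y| ≤ R := by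
    rintro (j | i) hk
    · have h0 : f (Sum.inl j) y = 0 := by simp [f, ((hmem y).1 hyS).1]
      rw [h0, sub_zero]
      exact (PiLp.norm_apply_le (h x) j).trans (le_add_of_nonneg_right (Real.sqrt_nonneg _))
    · have hi : 0 ≤ g y i.1 := by
        by_contra hn
        exact (Finset.mem_filter.1 hk).2 (dif_neg hn)
      have h0 : f (Sum.inr i) y = 0 := le_antisymm (((hmem y).1 hyS).2 i) hi
      rw [h0, sub_zero]
      refine (Real.abs_le_sqrt ?_).trans (le_add_of_nonneg_left (norm_nonneg _))
      exact Finset.single_le_sum (f := fun i => (g x i) ^ 2) (fun _ _ => sq_nonneg _)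
        (Finset.mem_filter.2 ⟨Finset.mem_univ i.1, hi⟩)
  have hsum : ∑ k with c k ≠ 0, |f k x - f k y|
      ≤ Fintype.card (Fin m ⊕ {i : Fin l // 0 ≤ g y₀ i}) * R := by
    refine (Finset.sum_le_card_nsmul _ _ _ hterm).trans ?_
    rw [nsmul_eq_mul]
    gcongr
    exact Finset.card_le_univ _
  rw [one_div, inv_mul_le_iff₀ (by positivity)]
  calc ‖x - y‖ ≤ C * (Fintype.card (Fin m ⊕ {i : Fin l // 0 ≤ g y₀ i}) * R) :=
        hmain.trans (by gcongr)
    _ ≤ _ := by rw [← mul_assoc, add_mul, one_mul]; exact le_add_of_nonneg_right hR0
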